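/- Let p be an imitation kernel with gcd(A) = 1 whose G-stochastic function P_(·) is irreducible but not aperiodic (i.e. the common period d̂ of all states satisfies d̂ > 1). Then 𝒢(p) contains at least two distinct compatible probability measures. -/

import Mathlib

open MeasureTheory
open scoped BigOperators

/-- The matrix of a word `𝐚 = (a_1, …, a_n)` (encoded as a list `[a_1, …, a_n]`),
namely `P_𝐚 = P_(a_n) ⋯ P_(a_1)`, so that `wordK P l i j` is the `(i,j)` entry. -/
noncomputable def wordK {G : Type*} [Fintype G] [DecidableEq G]
    (P : ℕ → G → G → ℝ) : List ℕ → G → G → ℝ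
  | [] => fun i j => if i = j then 1 else 0
  | a :: l => fun i j => ∑ m, wordK P l i m * P a m j

/-- A word over the alphabet `A`: a nonempty finite tuple with entries in `A`. -/
def IsWord (A : Set ℕ) (l : List ℕ) : Prop := l ≠ [] ∧ ∀ a ∈ l, a ∈ A

/-- `i` communicates with `j` if `P_𝐚(i,j) > 0` for some word `𝐚`. -/
def Communicates {G : Type*} [Fintype G] [DecidableEq G]
    (A : Set ℕ) (P : ℕ → G → G → ℝ) (i j : G) : Prop :=
  ∃ l : List ℕ, IsWord A l ∧ 0 < wordK P l i j

/-- `i` and `j` intercommunicate (every state intercommunicates with itself). -/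
def Intercommunicates {G : Type*} [Fintype G] [DecidableEq G]
    (A : Set ℕ) (P : ℕ → G → G → ℝ) (i j : G) : Prop :=
  i = j ∨ (Communicates A P i j ∧ Communicates A P j i)

/-- An intercommunicating class: an equivalence class of the intercommunication relation. -/
def IsInterClass {G : Type*} [Fintype G] [DecidableEq G]
    (A : Set ℕ) (P : ℕ → G → G → ℝ) (C : Set G) : Prop :=
  ∃ i : G, C = {j | Intercommunicates A P i j}

/-- A set `C` is closed if whenever `i ∈ C` communicates with `j`, then `j ∈ C`. -/
def IsClosedClass {G : Type*} [Fintype G] [DecidableEq G]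
    (A : Set ℕ) (P : ℕ → G → G → ℝ) (C : Set G) : Prop :=
  ∀ i ∈ C, ∀ j : G, Communicates A P i j → j ∈ C

/-- `d` is the greatest common divisor of the set `S ⊆ ℕ`. -/
def IsGCDOfSet (S : Set ℕ) (d : ℕ) : Prop :=
  (∀ n ∈ S, d ∣ n) ∧ ∀ e : ℕ, (∀ n ∈ S, e ∣ n) → e ∣ d

/-- The set of depths `s(𝐚)` of words `𝐚` with `P_𝐚(i,i) > 0`. -/
def ReturnDepths {G : Type*} [Fintype G] [DecidableEq G]
    (A : Set ℕ) (P : ℕ → G → G → ℝ) (i : G) : Set ℕ :=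
  {s | ∃ l : List ℕ, IsWord A l ∧ 0 < wordK P l i i ∧ l.sum = s}

/-- `E` is measurable with respect to the coordinates `(x_m)_{m < n}`. -/
def PastMeasurable {G : Type*} [MeasurableSpace G] (n : ℤ) (E : Set (ℤ → G)) : Prop :=
  MeasurableSet[MeasurableSpace.comap
    (fun x : ℤ → G => fun m : {m : ℤ // m < n} => x m.1) MeasurableSpace.pi] E

/-- `μ` is compatible with the imitation kernel
`p(g | w_{-1}, w_{-2}, …) = ∑_{k ∈ A} θ_k P_(k)(w_{-k}, g)` (here `θ` vanishes off `A`). -/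
def Compatible {G : Type*} [MeasurableSpace G] (θ : ℕ → ℝ) (P : ℕ → G → G → ℝ)
    (μ : Measure (ℤ → G)) : Prop :=
  ∀ (n : ℤ) (g : G) (E : Set (ℤ → G)), PastMeasurable n E →
    (μ (E ∩ {x | x n = g})).toReal
      = ∫ x in E, (∑' k : ℕ, θ k * P k (x (n - (k : ℤ))) g) ∂μ


lemma measurableSet_coord_mem {G : Type*} [Finite G] [MeasurableSpace G]
    [MeasurableSingletonClass G] (n : ℤ) (s : Set G) : MeasurableSet {x : ℤ → G | x n ∈ s} :=
  (show Measurable fun x : ℤ → G => x n by fun_prop) s.toFinite.measurableSet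

section Resampling

variable {G : Type*} [Fintype G]

/-- The operator averaging `f` over a resampling of coordinate `n` with probabilities `q n`. -/
noncomputable def resample (q : ℤ → G → (ℤ → G) → ℝ) (n : ℤ) (f : (ℤ → G) → ℝ) :
    (ℤ → G) → ℝ :=
  fun x => ∑ g, q n g x * f (Function.update x n g)

/-- Successive resampling of the coordinates `a, a + 1, …, a + m - 1`, in this order. -/
noncomputable def resampleIter (q : ℤ → G → (ℤ → G) → ℝ) (a : ℤ) :
    ℕ → ((ℤ → G) → ℝ) → (ℤ → G) → ℝ
  | 0 => id
  | m + 1 => fun f => resampleIter q a m (resample q (a + m) f)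

variable {q : ℤ → G → (ℤ → G) → ℝ}

lemma resampleIter_add (a : ℤ) (m : ℕ) (f f' : (ℤ → G) → ℝ) :
    resampleIter q a m (f + f') = resampleIter q a m f + resampleIter q a m f' := by
  induction m generalizing f f' with
  | zero => rfl
  | succ m ih =>
    simp only [resampleIter]
    rw [← ih]
    congr 1
    funext x
    simp [resample, mul_add, Finset.sum_add_distrib]

lemma resampleIter_smul (a : ℤ) (m : ℕ) (r : ℝ) (f : (ℤ → G) → ℝ) :
    resampleIter q a m (r • f) = r • resampleIter q a m f := by
  induction m generalizing f with
  | zero => rfl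
  | succ m ih =>
    simp only [resampleIter]
    rw [← ih]
    congr 1
    funext x
    simp [resample, Finset.mul_sum, mul_left_comm]

lemma resampleIter_mono (hnn : ∀ n g x, 0 ≤ q n g x) (a : ℤ) (m : ℕ)
    {f f' : (ℤ → G) → ℝ} (h : ∀ x, f x ≤ f' x) (x : ℤ → G) :
    resampleIter q a m f x ≤ resampleIter q a m f' x := by
  induction m generalizing f f' with
  | zero => exact h x
  | succ m ih =>
    exact ih fun y => Finset.sum_le_sum fun g _ => mul_le_mul_of_nonneg_left (h _) (hnn _ _ _)

/-- If `D` is preserved by all resamplings of positive probability, then resampling a function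
equal to a constant on `D` gives a function equal to this constant on `D`. -/
lemma resampleIter_eq_of_eqOn (hsum : ∀ n x, ∑ g, q n g x = 1) {D : Set (ℤ → G)}
    (hD : ∀ n g, ∀ x ∈ D, q n g x ≠ 0 → Function.update x n g ∈ D) (a : ℤ) (m : ℕ)
    {f : (ℤ → G) → ℝ} {r : ℝ} (h : ∀ x ∈ D, f x = r) :
    ∀ x ∈ D, resampleIter q a m f x = r := by
  induction m generalizing f with
  | zero => exact h
  | succ m ih =>
    refine ih fun x hx => ?_
    calc ∑ g, q (a + m) g x * f (Function.update x (a + m) g)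
        = ∑ g, q (a + m) g x * r := by
          refine Finset.sum_congr rfl fun g _ => ?_
          by_cases h0 : q (a + m) g x = 0
          · simp [h0]
          · rw [h _ (hD _ _ x hx h0)]
      _ = r := by rw [← Finset.sum_mul, hsum, one_mul]

lemma resample_eq_self (hsum : ∀ n x, ∑ g, q n g x = 1) {n : ℤ} {f : (ℤ → G) → ℝ}
    (hf : ∀ x g, f (Function.update x n g) = f x) : resample q n f = f := by
  funext x
  simp [resample, hf, ← Finset.sum_mul, hsum]

/-- Two functions of the coordinates up to `n` with the same resampling at `n` have the same
iterated resampling, as soon as `n` is among the resampled coordinates. -/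
lemma resampleIter_congr (hsum : ∀ n x, ∑ g, q n g x = 1) {a n : ℤ}
    {m : ℕ} (han : a ≤ n) (hnm : n < a + m) {f f' : (ℤ → G) → ℝ}
    (hf : ∀ k, n < k → ∀ x g, f (Function.update x k g) = f x)
    (hf' : ∀ k, n < k → ∀ x g, f' (Function.update x k g) = f' x)
    (h : resample q n f = resample q n f') :
    resampleIter q a m f = resampleIter q a m f' := by
  induction m with
  | zero => simp at hnm; omega
  | succ m ih =>
    simp only [resampleIter]
    rcases (show n = a + m ∨ n < a + m by push_cast at hnm; omega) with h1 | h1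
    · rw [← h1, h]
    · rw [resample_eq_self hsum (hf _ h1), resample_eq_self hsum (hf' _ h1), ih h1]

variable [TopologicalSpace G]

open scoped CompactlySupported
open Filter Topology

/-- The weak limit, along an ultrafilter, of the laws obtained by resampling the configuration `w`
on larger and larger windows. -/
lemma exists_limit_functional (hnn : ∀ n g x, 0 ≤ q n g x) (hsum : ∀ n x, ∑ g, q n g x = 1)
    {D : Set (ℤ → G)} (hD : ∀ n g, ∀ x ∈ D, q n g x ≠ 0 → Function.update x n g ∈ D)
    {w : ℤ → G} (hw : w ∈ D) :
    ∃ Λ : C_c(ℤ → G, ℝ) →ₚ[ℝ] ℝ,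
      (∀ f : C_c(ℤ → G, ℝ), (∀ x ∈ D, f x = 1) → Λ f = 1) ∧
      ∀ (n : ℤ) (f f' : C_c(ℤ → G, ℝ)),
        (∀ k, n < k → ∀ x g, f (Function.update x k g) = f x) →
        (∀ k, n < k → ∀ x g, f' (Function.update x k g) = f' x) →
        resample q n f = resample q n f' → Λ f = Λ f' := by
  let L : ℕ → ((ℤ → G) → ℝ) → ℝ := fun N f => resampleIter q (-N) (2 * N + 1) f w
  have hconst : ∀ N r, L N (fun _ => r) = r := fun N r =>
    resampleIter_eq_of_eqOn hsum hD _ _ (fun _ _ => rfl) w hw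
  have hmono : ∀ N f f', (∀ x, f x ≤ f' x) → L N f ≤ L N f' := fun N f f' h =>
    resampleIter_mono hnn _ _ h w
  have hlim : ∀ f : C_c(ℤ → G, ℝ), ∃ l, Tendsto (fun N => L N f) (hyperfilter ℕ) (𝓝 l) := by
    intro f
    obtain ⟨C, hC⟩ := f.hasCompactSupport.exists_bound_of_continuous f.continuous
    have hmem : ∀ N, L N f ∈ Set.Icc (-C) C := fun N =>
      ⟨(hconst N (-C)).symm.le.trans (hmono N _ _ fun x => (abs_le.1 (hC x)).1),
        (hmono N _ _ fun x => (abs_le.1 (hC x)).2).trans (hconst N C).le⟩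
    obtain ⟨l, -, hl⟩ := (isCompact_Icc (a := -C) (b := C)).ultrafilter_le_nhds
      ((hyperfilter ℕ).map fun N => L N f)
      (le_principal_iff.2 (mem_map.2 (Eventually.of_forall hmem)))
    exact ⟨l, hl⟩
  choose l hl using hlim
  refine ⟨PositiveLinearMap.mk₀
    { toFun := l
      map_add' := fun f f' => tendsto_nhds_unique (hl (f + f')) ?_
      map_smul' := fun r f => tendsto_nhds_unique (hl (r • f)) ?_ } ?_, ?_, ?_⟩
  · refine ((hl f).add (hl f')).congr fun N => ?_
    exact (congrFun (resampleIter_add _ _ f f') w).symm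
  · refine ((hl f).const_smul r).congr fun N => ?_
    exact (congrFun (resampleIter_smul _ _ r f) w).symm
  · intro f hf
    refine ge_of_tendsto' (hl f) fun N => ?_
    exact (hconst N 0).symm.le.trans (hmono N _ _ hf)
  · intro f hf
    refine tendsto_nhds_unique (hl f) (tendsto_const_nhds.congr fun N => ?_)
    exact (resampleIter_eq_of_eqOn hsum hD _ _ hf w hw).symm
  · intro n f f' hf hf' h
    refine tendsto_nhds_unique ((hl f).congr' ?_) (hl f')
    refine Nat.hyperfilter_le_atTop ?_
    filter_upwards [eventually_ge_atTop n.natAbs] with N hN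
    exact congrFun (resampleIter_congr hsum (by omega) (by push_cast; omega) hf hf' h) w

variable [DiscreteTopology G] [MeasurableSpace G] [BorelSpace G]

/-- A finite measure satisfies the compatibility condition on past events as soon as it does so on
continuous functions of the past. -/
lemma setIntegral_past_of_integral_continuous {μ : Measure (ℤ → G)} [IsFiniteMeasure μ] {n : ℤ}
    {S : Set (ℤ → G)} {p : (ℤ → G) → ℝ} (hp : Continuous p)
    (hp0 : ∀ x, 0 ≤ p x)
    (h : ∀ f : ({m : ℤ // m < n} → G) → ℝ, Continuous f →
      ∫ x in S, f (fun m => x m) ∂μ = ∫ x, p x * f (fun m => x m) ∂μ)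
    {E : Set (ℤ → G)} (hE : PastMeasurable n E) :
    (μ (E ∩ S)).toReal = ∫ x in E, p x ∂μ := by
  set ρ : (ℤ → G) → ({m : ℤ // m < n} → G) := fun x m => x m with hρ
  have hρm : Measurable ρ := by fun_prop
  have hpi : Integrable p μ := by
    obtain ⟨C, hC⟩ := (HasCompactSupport.of_compactSpace p).exists_bound_of_continuous hp
    exact Integrable.of_bound hp.aestronglyMeasurable C (Eventually.of_forall hC)
  have hpm : Measurable fun x => ENNReal.ofReal (p x) := hp.measurable.ennreal_ofReal
  have hfin : IsFiniteMeasure (μ.withDensity fun x => ENNReal.ofReal (p x)) :=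
    isFiniteMeasure_withDensity_ofReal hpi.2
  have key : (μ.restrict S).map ρ = (μ.withDensity fun x => ENNReal.ofReal (p x)).map ρ := by
    refine ext_of_forall_integral_eq_of_IsFiniteMeasure fun f => ?_
    rw [integral_map hρm.aemeasurable f.continuous.aestronglyMeasurable,
      integral_map hρm.aemeasurable f.continuous.aestronglyMeasurable,
      integral_withDensity_eq_integral_toReal_smul hpm (by simp), h f f.continuous]
    simp [ENNReal.toReal_ofReal, hp0, hρ]
  obtain ⟨F, hF, rfl⟩ := hE
  have hEm : MeasurableSet (ρ ⁻¹' F) := hρm hF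
  have := congrArg (fun ν => (ν F).toReal) key
  simp only [Measure.map_apply hρm hF, Measure.restrict_apply hEm, withDensity_apply _ hEm] at this
  rw [this, integral_eq_lintegral_of_nonneg_ae (Eventually.of_forall hp0)
    hp.aestronglyMeasurable]

/-- Existence of measures compatible with a continuous kernel and carried by an invariant set. -/
lemma exists_isProbabilityMeasure_of_kernel (hcont : ∀ n g, Continuous (q n g))
    (hnn : ∀ n g x, 0 ≤ q n g x) (hsum : ∀ n x, ∑ g, q n g x = 1)
    (hpast : ∀ n g x k g', n ≤ k → q n g (Function.update x k g') = q n g x)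
    {D : Set (ℤ → G)} (hD : ∀ n g, ∀ x ∈ D, q n g x ≠ 0 → Function.update x n g ∈ D)
    {w : ℤ → G} (hw : w ∈ D) :
    ∃ μ : Measure (ℤ → G), IsProbabilityMeasure μ ∧
      (∀ n g E, PastMeasurable n E → (μ (E ∩ {x | x n = g})).toReal = ∫ x in E, q n g x ∂μ) ∧
      ∀ f : (ℤ → G) → ℝ, Continuous f → (∀ x ∈ D, f x = 1) → ∫ x, f x ∂μ = 1 := by
  classical
  obtain ⟨Λ, hΛ1, hΛ⟩ := exists_limit_functional hnn hsum hD hw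
  let toCc : (f : (ℤ → G) → ℝ) → Continuous f → C_c(ℤ → G, ℝ) := fun f hf =>
    ⟨⟨f, hf⟩, HasCompactSupport.of_compactSpace f⟩
  have hint : ∀ (f : (ℤ → G) → ℝ) (hf : Continuous f),
      ∫ x, f x ∂(RealRMK.rieszMeasure Λ) = Λ (toCc f hf) := fun f hf =>
    RealRMK.integral_rieszMeasure Λ (toCc f hf)
  have hone : ∀ f : (ℤ → G) → ℝ, Continuous f → (∀ x ∈ D, f x = 1) →
      ∫ x, f x ∂(RealRMK.rieszMeasure Λ) = 1 := fun f hf h => by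
    rw [hint f hf]
    exact hΛ1 _ h
  refine ⟨RealRMK.rieszMeasure Λ, ⟨?_⟩, fun n g E hE => ?_, hone⟩
  · have h1 := hone (fun _ => 1) continuous_const fun _ _ => rfl
    rw [integral_const, smul_eq_mul, mul_one, measureReal_def] at h1
    exact (ENNReal.toReal_eq_one_iff _).1 h1
  · have hS : MeasurableSet {x : ℤ → G | x n = g} :=
      measurableSet_coord_mem n {g}
    refine setIntegral_past_of_integral_continuous (hcont n g) (hnn n g) (fun f hf => ?_) hE
    have hf' : Continuous fun x : ℤ → G => f fun m : {m : ℤ // m < n} => x m := by fun_prop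
    have hind : Continuous fun x : ℤ → G => (if x n = g then (1 : ℝ) else 0) :=
      (continuous_of_discreteTopology (f := fun i : G => if i = g then (1 : ℝ) else 0)).comp
        (continuous_apply n)
    have hup : ∀ k, n ≤ k → ∀ (x : ℤ → G) (g' : G),
        (f fun m : {m : ℤ // m < n} => Function.update x k g' m) = f fun m => x m := by
      intro k hk x g'
      congr 1
      funext m
      exact Function.update_of_ne (by have := m.2; omega) _ _
    have hleft : ∫ x in {x : ℤ → G | x n = g}, f (fun m => x m) ∂(RealRMK.rieszMeasure Λ) =
        ∫ x, (if x n = g then (1 : ℝ) else 0) * f (fun m => x m) ∂(RealRMK.rieszMeasure Λ) := by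
      rw [← integral_indicator hS]
      congr 1
      funext x
      simp [Set.indicator_apply]
    refine hleft.trans (((hint _ (hind.mul hf')).trans ?_).trans (hint _ ((hcont n g).mul hf')).symm)
    refine hΛ n _ _ (fun k hk x g' => ?_) (fun k hk x g' => ?_) ?_
    · change (if Function.update x k g' n = g then (1 : ℝ) else 0) *
        (f fun m => Function.update x k g' m) = (if x n = g then (1 : ℝ) else 0) * f fun m => x m
      rw [hup k hk.le, Function.update_of_ne hk.ne]
    · change q n g (Function.update x k g') * (f fun m => Function.update x k g' m) =
        q n g x * f fun m => x m
      rw [hup k hk.le, hpast n g x k g' hk.le]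
    · funext x
      change ∑ g', q n g' x * ((if Function.update x n g' n = g then (1 : ℝ) else 0) *
          (f fun m => Function.update x n g' m)) =
        ∑ g', q n g' x * (q n g (Function.update x n g') * f fun m => Function.update x n g' m)
      simp_rw [hup n le_rfl, hpast n g x n _ le_rfl, ← Finset.sum_mul, hsum]
      simp

end Resampling

section Words

variable {G : Type*} [Fintype G] [DecidableEq G] {A : Set ℕ} {P : ℕ → G → G → ℝ}

lemma wordK_nonneg (hPnn : ∀ k ∈ A, ∀ i j : G, 0 ≤ P k i j) {l : List ℕ} (hl : ∀ a ∈ l, a ∈ A)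
    (i j : G) : 0 ≤ wordK P l i j := by
  induction l generalizing j with
  | nil => simp only [wordK]; split_ifs <;> norm_num
  | cons a l ih =>
    simp only [List.mem_cons, forall_eq_or_imp] at hl
    exact Finset.sum_nonneg fun m _ => mul_nonneg (ih hl.2 m) (hPnn a hl.1 _ _)

lemma wordK_append (l l' : List ℕ) (i j : G) :
    wordK P (l' ++ l) i j = ∑ m, wordK P l i m * wordK P l' m j := by
  induction l' generalizing j with
  | nil => simp [wordK]
  | cons a l' ih =>
    simp only [List.cons_append, wordK, ih, Finset.sum_mul, Finset.mul_sum]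
    rw [Finset.sum_comm]
    simp only [mul_assoc]

lemma wordK_append_pos (hPnn : ∀ k ∈ A, ∀ i j : G, 0 ≤ P k i j) {l l' : List ℕ}
    (hl : ∀ a ∈ l, a ∈ A) (hl' : ∀ a ∈ l', a ∈ A) {i m j : G}
    (h : 0 < wordK P l i m) (h' : 0 < wordK P l' m j) : 0 < wordK P (l' ++ l) i j := by
  rw [wordK_append]
  exact (mul_pos h h').trans_le <| Finset.single_le_sum
    (f := fun m => wordK P l i m * wordK P l' m j)
    (fun m _ => mul_nonneg (wordK_nonneg hPnn hl i m) (wordK_nonneg hPnn hl' m j))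
    (Finset.mem_univ m)

/-- The cyclic classes: a `ZMod d`-valued phase which advances by `k` under each `P k`. -/
lemma exists_phase [Nonempty G] (hPnn : ∀ k ∈ A, ∀ i j : G, 0 ≤ P k i j)
    (hirr : ∀ i j : G, Communicates A P i j) {d : ℕ}
    (hd : ∀ i : G, ∀ n ∈ ReturnDepths A P i, d ∣ n) :
    ∃ c : G → ZMod d, ∀ k ∈ A, ∀ i j, 0 < P k i j → c j = c i + k := by
  obtain ⟨o⟩ := ‹Nonempty G›
  choose l hl hlpos using hirr o
  refine ⟨fun j => ((l j).sum : ZMod d), fun k hk i j hij => ?_⟩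
  obtain ⟨r, hr, hrpos⟩ := hirr j o
  have hk' : ∀ a ∈ [k], a ∈ A := by simpa using hk
  have hkpos : 0 < wordK P [k] i j := by simpa [wordK] using hij
  have hki : ∀ a ∈ [k] ++ l i, a ∈ A := fun a ha =>
    (List.mem_append.1 ha).elim (hk' a) ((hl i).2 a)
  have hreturn : ∀ s : List ℕ, (∀ a ∈ s, a ∈ A) → 0 < wordK P s o j →
      ((s.sum : ℕ) : ZMod d) = -(r.sum : ℕ) := by
    intro s hs hspos
    have hword : IsWord A (r ++ s) :=
      ⟨by simp [hr.1], fun a ha => (List.mem_append.1 ha).elim (hr.2 a) (hs a)⟩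
    have := (ZMod.natCast_eq_zero_iff _ _).2 (hd o _
      ⟨r ++ s, hword, wordK_append_pos hPnn hs hr.2 hspos hrpos, rfl⟩)
    rw [List.sum_append, Nat.cast_add] at this
    exact eq_neg_of_add_eq_zero_right this
  have h1 := hreturn (l j) (hl j).2 (hlpos j)
  have h2 := hreturn ([k] ++ l i) hki
    (wordK_append_pos hPnn (hl i).2 hk' (hlpos i) hkpos)
  change ((l j).sum : ZMod d) = (l i).sum + k
  rw [h1, ← h2]
  simp [add_comm]

end Words

lemma phase_surjective {G : Type*} [Nonempty G] {A : Set ℕ} {P : ℕ → G → G → ℝ}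
    (hrow : ∀ k ∈ A, ∀ i : G, ∃ j, 0 < P k i j)
    (hgcdA : IsGCDOfSet A 1) {d : ℕ} [NeZero d]
    {c : G → ZMod d} (hc : ∀ k ∈ A, ∀ i j, 0 < P k i j → c j = c i + k) :
    Function.Surjective c := by
  let M : AddSubgroup (ZMod d) :=
    { carrier := {z | ∀ i, ∃ j, c j = c i + z}
      zero_mem' := fun i => ⟨i, by simp⟩
      add_mem' := fun {y z} hy hz i => by
        obtain ⟨j, hj⟩ := hy i
        obtain ⟨k, hk⟩ := hz j
        exact ⟨k, by rw [hk, hj, add_assoc]⟩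
      neg_mem' := fun {z} hz => by
        have hmul : ∀ (n : ℕ) (i : G), ∃ j, c j = c i + n • z := by
          intro n
          induction n with
          | zero => exact fun i => ⟨i, by simp⟩
          | succ n ih =>
            intro i
            obtain ⟨j, hj⟩ := ih i
            obtain ⟨k, hk⟩ := hz j
            exact ⟨k, by rw [hk, hj, succ_nsmul, add_assoc]⟩
        have hneg : -z = (d - 1) • z := by
          have h0 : ((d - 1) + 1) • z = 0 := by
            rw [Nat.sub_add_cancel (NeZero.one_le)]
            simp
          rw [succ_nsmul] at h0
          exact (eq_neg_of_add_eq_zero_left h0).symm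
        intro i
        rw [hneg]
        exact hmul _ i }
  have hAM : ∀ k ∈ A, (k : ZMod d) ∈ M := fun k hk i => by
    obtain ⟨j, hj⟩ := hrow k hk i
    exact ⟨j, hc k hk i j hj⟩
  have h1 : (1 : ZMod d) ∈ M := by
    obtain ⟨e, he⟩ := Int.subgroup_cyclic (M.comap (Int.castAddHom (ZMod d)))
    have hmem : ∀ n : ℤ, (n : ZMod d) ∈ M ↔ e ∣ n := by
      intro n
      rw [← Int.mem_zmultiples_iff, AddSubgroup.zmultiples_eq_closure, ← he]
      rfl
    have he1 : e.natAbs ∣ 1 := hgcdA.2 _ fun k hk =>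
      Int.natAbs_dvd_natAbs.2 ((hmem k).1 (by simpa using hAM k hk))
    have := (hmem 1).2 (Int.natAbs_dvd_natAbs.1 he1)
    simpa using this
  intro z
  obtain ⟨i⟩ := ‹Nonempty G›
  have hz : z - c i ∈ M := by
    have := M.nsmul_mem h1 (z - c i).val
    simpa using this
  obtain ⟨j, hj⟩ := hz i
  exact ⟨j, by simpa using hj⟩

section ImitationKernel

variable {G : Type*} [Fintype G] {A : Set ℕ} {θ : ℕ → ℝ} {P : ℕ → G → G → ℝ}

lemma stochastic_le_one (hPnn : ∀ k ∈ A, ∀ i j : G, 0 ≤ P k i j)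
    (hProw : ∀ k ∈ A, ∀ i : G, ∑ j, P k i j = 1) {k : ℕ} (hk : k ∈ A) (i j : G) :
    P k i j ≤ 1 :=
  (Finset.single_le_sum (fun j _ => hPnn k hk i j) (Finset.mem_univ j)).trans_eq (hProw k hk i)

lemma weighted_mem_Icc (hθpos : ∀ k ∈ A, 0 < θ k) (hθ0 : ∀ k, k ∉ A → θ k = 0)
    (hPnn : ∀ k ∈ A, ∀ i j : G, 0 ≤ P k i j) (hProw : ∀ k ∈ A, ∀ i : G, ∑ j, P k i j = 1)
    (k : ℕ) (i j : G) : θ k * P k i j ∈ Set.Icc 0 (θ k) := by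
  by_cases hk : k ∈ A
  · exact ⟨mul_nonneg (hθpos k hk).le (hPnn k hk i j),
      mul_le_of_le_one_right (hθpos k hk).le (stochastic_le_one hPnn hProw hk i j)⟩
  · simp [hθ0 k hk]

/-- Existence of a compatible measure following a prescribed phase. -/
lemma exists_compatible_of_phase [MeasurableSpace G] [MeasurableSingletonClass G]
    (hApos : ∀ k ∈ A, 0 < k) (hθpos : ∀ k ∈ A, 0 < θ k) (hθ0 : ∀ k, k ∉ A → θ k = 0)
    (hθsum : HasSum θ 1) (hPnn : ∀ k ∈ A, ∀ i j : G, 0 ≤ P k i j)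
    (hProw : ∀ k ∈ A, ∀ i : G, ∑ j, P k i j = 1) {d : ℕ} {c : G → ZMod d}
    (hc : ∀ k ∈ A, ∀ i j, 0 < P k i j → c j = c i + k) (hsurj : Function.Surjective c)
    (r : ZMod d) :
    ∃ μ : Measure (ℤ → G), IsProbabilityMeasure μ ∧ Compatible θ P μ ∧
      μ {x | c (x 0) = r} = 1 := by
  classical
  let : TopologicalSpace G := ⊥
  have : DiscreteTopology G := ⟨rfl⟩
  have : BorelSpace G := ⟨by
    rw [borel_eq_top_of_discrete]
    exact top_le_iff.1 fun s _ => s.toFinite.measurableSet⟩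
  have hterm := weighted_mem_Icc hθpos hθ0 hPnn hProw
  have hsummable : ∀ (n : ℤ) (g : G) (x : ℤ → G),
      Summable fun k : ℕ => θ k * P k (x (n - (k : ℤ))) g := fun n g x =>
    Summable.of_nonneg_of_le (fun k => (hterm k _ _).1) (fun k => (hterm k _ _).2) hθsum.summable
  choose s hs using hsurj
  obtain ⟨μ, hμ, hcompat, hD⟩ := exists_isProbabilityMeasure_of_kernel
    (q := fun n g x => ∑' k : ℕ, θ k * P k (x (n - (k : ℤ))) g)
    (D := {x | ∀ m, c (x m) = m + r}) (w := fun m => s (m + r))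
    (fun n g => continuous_tsum
      (fun k => continuous_const.mul
        ((continuous_of_discreteTopology (f := fun i : G => P k i g)).comp (continuous_apply _)))
      hθsum.summable
      fun k x => by
        rw [Real.norm_of_nonneg (hterm k _ _).1]
        exact (hterm k _ _).2)
    (fun n g x => tsum_nonneg fun k => (hterm k _ _).1)
    (fun n x => by
      rw [← Summable.tsum_finsetSum fun g _ => hsummable n g x, ← hθsum.tsum_eq]
      refine tsum_congr fun k => ?_
      rw [← Finset.mul_sum]
      by_cases hk : k ∈ A
      · rw [hProw k hk, mul_one]
      · rw [hθ0 k hk, zero_mul])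
    (fun n g x k g' hk => tsum_congr fun a => by
      by_cases ha : a ∈ A
      · have := hApos a ha
        rw [Function.update_of_ne (by omega)]
      · rw [hθ0 a ha, zero_mul, zero_mul])
    (fun n g x hx hq m => by
      by_cases hm : m = n
      · subst hm
        obtain ⟨k, hk⟩ : ∃ k : ℕ, θ k * P k (x (m - (k : ℤ))) g ≠ 0 := by
          by_contra! h
          exact hq (by simp [h])
        have hkA : k ∈ A := by
          by_contra h
          exact hk (by simp [hθ0 k h])
        have hpos : 0 < P k (x (m - (k : ℤ))) g :=
          (hPnn k hkA _ _).lt_of_ne' (right_ne_zero_of_mul hk)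
        rw [Function.update_self, hc k hkA _ _ hpos, hx]
        push_cast
        ring
      · rw [Function.update_of_ne hm]
        exact hx m)
    (fun m => hs _)
  refine ⟨μ, hμ, hcompat, ?_⟩
  have hmeas : MeasurableSet {x : ℤ → G | c (x 0) = r} :=
    measurableSet_coord_mem 0 {i | c i = r}
  have h1 := hD ({x : ℤ → G | c (x 0) = r}.indicator fun _ => 1)
    ((continuous_of_discreteTopology (f := {i : G | c i = r}.indicator fun _ => (1 : ℝ))).comp
      (continuous_apply 0))
    (fun x hx => by simp [hx 0])
  rw [integral_indicator_const _ hmeas, smul_eq_mul, mul_one, measureReal_def] at h1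
  exact (ENNReal.toReal_eq_one_iff _).1 h1

end ImitationKernel

/-- irreducible but not aperiodic (`d̂ > 1`, with `gcd(A) = 1`)
implies `|𝒢(p)| > 1`. -/
theorem stmt_8 {G : Type*} [Fintype G] [DecidableEq G] [Nonempty G]
    [MeasurableSpace G] [MeasurableSingletonClass G]
    (A : Set ℕ) (hA : A.Nonempty) (hApos : ∀ k ∈ A, 0 < k)
    (θ : ℕ → ℝ) (hθpos : ∀ k ∈ A, 0 < θ k) (hθ0 : ∀ k, k ∉ A → θ k = 0)
    (hθsum : HasSum θ 1)
    (P : ℕ → G → G → ℝ)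
    (hPnn : ∀ k ∈ A, ∀ i j : G, 0 ≤ P k i j)
    (hProw : ∀ k ∈ A, ∀ i : G, ∑ j, P k i j = 1)
    (hirr : ∀ i j : G, Communicates A P i j)
    (hgcdA : IsGCDOfSet A 1)
    (dhat : ℕ) (hper : ∀ i : G, IsGCDOfSet (ReturnDepths A P i) dhat)
    (hd : 1 < dhat) :
    ∃ μ ν : Measure (ℤ → G),
      IsProbabilityMeasure μ ∧ Compatible θ P μ ∧
      IsProbabilityMeasure ν ∧ Compatible θ P ν ∧ μ ≠ ν := by
  have : NeZero dhat := ⟨by omega⟩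
  have : Fact (1 < dhat) := ⟨hd⟩
  obtain ⟨c, hc⟩ := exists_phase hPnn hirr fun i => (hper i).1
  have hrow : ∀ k ∈ A, ∀ i : G, ∃ j, 0 < P k i j := by
    intro k hk i
    by_contra! h
    have := Finset.sum_nonpos fun j (_ : j ∈ Finset.univ) => h j
    linarith [hProw k hk i]
  have hsurj := phase_surjective hrow hgcdA hc
  obtain ⟨μ, hμ, hμc, hμ0⟩ :=
    exists_compatible_of_phase hApos hθpos hθ0 hθsum hPnn hProw hc hsurj 0
  obtain ⟨ν, hν, hνc, hν1⟩ :=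
    exists_compatible_of_phase hApos hθpos hθ0 hθsum hPnn hProw hc hsurj 1
  refine ⟨μ, ν, hμ, hμc, hν, hνc, ?_⟩
  rintro rfl
  have hmeas : MeasurableSet {x : ℤ → G | c (x 0) = 1} :=
    measurableSet_coord_mem 0 {i | c i = 1}
  have hdisj : Disjoint {x : ℤ → G | c (x 0) = 0} {x : ℤ → G | c (x 0) = 1} :=
    Set.disjoint_left.2 fun x h0 h1 => zero_ne_one (h0.symm.trans h1)
  have hle := prob_le_one (μ := μ)
    (s := {x : ℤ → G | c (x 0) = 0} ∪ {x : ℤ → G | c (x 0) = 1})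
  rw [measure_union hdisj hmeas, hμ0, hν1] at hle
  norm_num at hle
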